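/- arXiv:2203.11837 — 2 statements merged into one kernel-verified Lean document; each statement's English description precedes it below -/
import Mathlib

section
/- Let A, B be invertible n×n complex matrices. There exists an invertible matrix H such that both H A and H* B are strictly accretive if and only if A B has no eigenvalue on the closed negative real axis (-∞, 0]. -/
open Matrix ComplexOrder

/-- A complex number off the closed negative real axis can be rotated, together with `1`, into the
open right half-plane. -/
lemma exists_re_pos_and_re_mul_pos {z : ℂ} (hz : ∀ r : ℝ, r ≤ 0 → (r : ℂ) ≠ z) :
    ∃ k : ℂ, 0 < k.re ∧ 0 < (k * z).re := by
  by_cases ha : 0 < z.re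
  · exact ⟨1, by simp, by simpa using ha⟩
  · have hb : z.im ≠ 0 := fun hb =>
      hz z.re (not_lt.1 ha) (Complex.ext (by simp) (by simp [hb]))
    refine ⟨⟨1, -((1 - z.re) / z.im)⟩, by simp, ?_⟩
    simp [Complex.mul_re, hb]

lemma Complex.neg_norm_mul_norm_le_re_mul (z w : ℂ) : -(‖z‖ * ‖w‖) ≤ (z * w).re := by
  have h := Complex.abs_re_le_norm (z * w)
  rw [norm_mul] at h
  exact (abs_le.1 h).1

/-- An endomorphism `f` of a finite-dimensional complex space without eigenvalues in `(-∞, 0]`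
admits a sesquilinear form `K` such that `K v v` and `K v (f v)` have positive real part.
Positivity of the latter is expressed as a domination of all antilinear functionals. -/
theorem Module.End.exists_sesquilinear_re_pos (d : ℕ) :
    ∀ (V : Type*) [AddCommGroup V] [Module ℂ V] [FiniteDimensional ℂ V] (f : Module.End ℂ V),
      Module.finrank ℂ V = d → (∀ r : ℝ, r ≤ 0 → ¬ f.HasEigenvalue (r : ℂ)) →
      ∃ K : V →ₗ⋆[ℂ] V →ₗ[ℂ] ℂ, (∀ v, v ≠ 0 → 0 < (K v v).re) ∧
        ∀ ψ : V →ₗ⋆[ℂ] ℂ, ∃ C : ℝ, 0 < C ∧ ∀ v, ‖ψ v‖ ^ 2 ≤ C * (K v (f v)).re := by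
  induction d with
  | zero =>
    intro V _ _ _ f hd _
    have := Module.finrank_zero_iff.1 hd
    refine ⟨0, fun v hv => (hv (Subsingleton.elim _ _)).elim, fun ψ => ⟨1, one_pos, fun v => ?_⟩⟩
    simp [Subsingleton.elim v 0]
  | succ d ih =>
    intro V _ _ _ f hd hf
    have : Nontrivial V := Module.nontrivial_of_finrank_pos (R := ℂ) (by omega)
    obtain ⟨μ, hμ⟩ := Module.End.exists_eigenvalue (K := ℂ) (V := Module.Dual ℂ V) f.dualMap
    obtain ⟨φ, hφ⟩ := hμ.exists_hasEigenvector
    have hφf : ∀ v, φ (f v) = μ * φ v := fun v => by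
      simpa using LinearMap.congr_fun hφ.apply_eq_smul v
    have hμf : f.HasEigenvalue μ := by
      rw [Module.End.hasEigenvalue_iff_mem_spectrum]
      intro hu
      apply hφ.2
      ext v
      obtain ⟨g, hg⟩ := hu.exists_right_inv
      have := LinearMap.congr_fun hg v
      simp only [Module.End.mul_apply, LinearMap.sub_apply, Module.End.one_apply,
        Module.algebraMap_end_apply] at this
      rw [← this, map_sub, hφf, map_smul, smul_eq_mul, sub_self, LinearMap.zero_apply]
    obtain ⟨k, hk, hkμ⟩ := exists_re_pos_and_re_mul_pos (z := μ)
      (fun r hr h => hf r hr (h ▸ hμf))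
    obtain ⟨u, hu⟩ := LinearMap.surjective hφ.2 1
    let W := LinearMap.ker φ
    have hW : ∀ w ∈ W, f w ∈ W := fun w hw => by
      rw [LinearMap.mem_ker] at hw ⊢
      rw [hφf, hw, mul_zero]
    let g : Module.End ℂ W := f.restrict hW
    let π : V →ₗ[ℂ] W := (LinearMap.id - φ.smulRight u).codRestrict W
      (fun v => by simp [W, hu])
    have hπ : ∀ v, (π v : V) + φ v • u = v := fun v =>
      sub_add_cancel v (φ v • u)
    have hdW : Module.finrank ℂ W = d := by
      have : Module.finrank ℂ W + 1 = _ := Module.Dual.finrank_ker_add_one_of_ne_zero hφ.2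
      omega
    obtain ⟨K, hK, hC⟩ := ih W g hdW fun r hr h => by
      obtain ⟨w, hw⟩ := h.exists_hasEigenvector
      refine hf r hr (Module.End.hasEigenvalue_of_hasEigenvector (x := (w : V)) ⟨?_, ?_⟩)
      · rw [Module.End.mem_eigenspace_iff]
        exact congrArg Subtype.val hw.apply_eq_smul
      · simpa using hw.2
    have hπf : ∀ v, π (f v) = g (π v) + φ v • π (f u) := fun v => by
      have h : f (π v) + φ v • f u = f v := by rw [← map_smul, ← map_add, hπ]
      have h' : π (f (π v)) = g (π v) := by
        have h0 : φ (f (π v)) = 0 := hW _ (π v).2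
        have h1 := hπ (f (π v))
        rw [h0, zero_smul, add_zero] at h1
        exact Subtype.ext h1
      rw [← h, map_add, map_smul, h']
    obtain ⟨C, hC0, hCy⟩ := hC (K.flip (π (f u)))
    let t : ℝ := (1 + C / 2) / (k * μ).re
    have ht : 0 < t := by positivity
    let L : V →ₗ⋆[ℂ] V →ₗ[ℂ] ℂ :=
      (K.comp π).compl₂ π +
        (LinearMap.toSpanSingleton ℂ (V →ₗ[ℂ] ℂ) (((t : ℂ) * k) • φ)).comp
          ((starLinearEquiv ℂ : ℂ ≃ₗ⋆[ℂ] ℂ).toLinearMap.comp φ)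
    have hL : ∀ v w, L v w = K (π v) (π w) + t * k * (star (φ v) * φ w) := fun v w => by
      simp [L]
      ring
    have hnorm : ∀ (z : ℂ), star z * z = ((‖z‖ ^ 2 : ℝ) : ℂ) := fun z => by
      simpa using Complex.conj_mul' z
    have hLv : ∀ v, (L v v).re = (K (π v) (π v)).re + t * k.re * ‖φ v‖ ^ 2 := fun v => by
      rw [hL, hnorm, Complex.add_re, Complex.re_mul_ofReal, Complex.re_ofReal_mul]
    have hLf : ∀ v, (K (π v) (g (π v))).re / 2 + ‖φ v‖ ^ 2 ≤ (L v (f v)).re := fun v => by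
      have h1 : L v (f v) = K (π v) (g (π v)) + φ v * K (π v) (π (f u)) +
          ((t * ‖φ v‖ ^ 2 : ℝ) : ℂ) * (k * μ) := by
        have := hnorm (φ v)
        push_cast at this
        rw [hL, hπf, hφf, map_add, map_smul, smul_eq_mul]
        push_cast
        rw [← this]
        ring
      have h2 : t * (k * μ).re = 1 + C / 2 := div_mul_cancel₀ _ hkμ.ne'
      have h3 := Complex.neg_norm_mul_norm_le_re_mul (φ v) (K (π v) (π (f u)))
      have h4 : ‖K (π v) (π (f u))‖ ^ 2 ≤ C * (K (π v) (g (π v))).re := hCy (π v)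
      rw [h1, Complex.add_re, Complex.add_re, Complex.re_ofReal_mul, mul_right_comm, h2]
      set a := ‖φ v‖
      set b := ‖K (π v) (π (f u))‖
      set q := (K (π v) (g (π v))).re
      have h5 : a * b ≤ q / 2 + C / 2 * a ^ 2 := by
        refine le_of_mul_le_mul_left ?_ hC0
        nlinarith [sq_nonneg (C * a - b)]
      linarith
    refine ⟨L, fun v hv => ?_, fun ψ => ?_⟩
    · rw [hLv]
      by_cases h0 : π v = 0
      · have h1 : φ v ≠ 0 := fun h1 => hv (by rw [← hπ v, h0, h1]; simp)
        rw [h0]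
        simp only [map_zero, Complex.zero_re, zero_add]
        positivity
      · have := hK _ h0
        positivity
    · obtain ⟨D, hD0, hD⟩ := hC (ψ.comp W.subtype)
      refine ⟨4 * D + 2 * ‖ψ u‖ ^ 2, by positivity, fun v => ?_⟩
      refine le_trans ?_ (mul_le_mul_of_nonneg_left (hLf v) (by positivity))
      have h1 : ‖ψ (π v)‖ ^ 2 ≤ D * (K (π v) (g (π v))).re := hD (π v)
      have h2 : ‖ψ v‖ ≤ ‖ψ (π v)‖ + ‖φ v‖ * ‖ψ u‖ := by
        conv_lhs => rw [← hπ v, map_add]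
        refine (norm_add_le _ _).trans_eq ?_
        simp
      have hq : 0 ≤ (K (π v) (g (π v))).re :=
        nonneg_of_mul_nonneg_right ((sq_nonneg _).trans h1) hD0
      have h3 : ‖ψ v‖ ^ 2 ≤ (‖ψ (π v)‖ + ‖φ v‖ * ‖ψ u‖) ^ 2 := by gcongr
      nlinarith [sq_nonneg (‖ψ (π v)‖ - ‖φ v‖ * ‖ψ u‖), mul_nonneg hD0.le (sq_nonneg ‖φ v‖),
        mul_nonneg (sq_nonneg ‖ψ u‖) hq]

/-- A matrix is strictly accretive iff its quadratic form takes values in the open right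
half-plane. -/
lemma Matrix.posDef_add_conjTranspose_iff {n : ℕ} (X : Matrix (Fin n) (Fin n) ℂ) :
    (X + Xᴴ).PosDef ↔ ∀ x, x ≠ 0 → 0 < (star x ⬝ᵥ X *ᵥ x).re := by
  have h : ∀ x, star x ⬝ᵥ (X + Xᴴ) *ᵥ x = ((2 * (star x ⬝ᵥ X *ᵥ x).re : ℝ) : ℂ) := fun x => by
    have : star x ⬝ᵥ Xᴴ *ᵥ x = star (star x ⬝ᵥ X *ᵥ x) := by
      rw [star_dotProduct, star_mulVec, conjTranspose_conjTranspose, dotProduct_mulVec]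
    rw [add_mulVec, dotProduct_add, this]
    exact Complex.add_conj _
  rw [posDef_iff_dotProduct_mulVec]
  refine ⟨fun hX x hx => ?_, fun hX => ⟨by simp [IsHermitian, add_comm], fun x hx => ?_⟩⟩
  · have := hX.2 hx
    rw [h, Complex.zero_lt_real] at this
    linarith
  · rw [h, Complex.zero_lt_real]
    linarith [hX x hx]

/-- A matrix without eigenvalues in `(-∞, 0]` becomes strictly accretive after multiplication by a
suitable strictly accretive matrix. -/
theorem Matrix.exists_accretive_mul_accretive {n : ℕ} (M : Matrix (Fin n) (Fin n) ℂ)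
    (hM : ∀ r : ℝ, r ≤ 0 → (r : ℂ) ∉ spectrum ℂ M) :
    ∃ K : Matrix (Fin n) (Fin n) ℂ, (K + Kᴴ).PosDef ∧ (K * M + (K * M)ᴴ).PosDef := by
  obtain ⟨K, hK, hC⟩ := Module.End.exists_sesquilinear_re_pos n (Fin n → ℂ) (toLin' M) (by simp)
    fun r hr h => hM r hr (by
      rw [Module.End.hasEigenvalue_iff_mem_spectrum, Matrix.spectrum_toLin'] at h
      exact h)
  let N : Matrix (Fin n) (Fin n) ℂ := LinearMap.toMatrixₛₗ₂' ℂ K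
  have hmat : ∀ x y, star x ⬝ᵥ N *ᵥ y = K x y := by
    intro x y
    rw [← Matrix.toLinearMapₛₗ₂'_toMatrix' (R := ℂ) (starRingEnd ℂ) (RingHom.id ℂ) K, Matrix.toLinearMapₛₗ₂'_apply]
    simp [N, dotProduct, mulVec, Finset.mul_sum, mul_comm]
  refine ⟨N, ?_, ?_⟩ <;>
    rw [posDef_add_conjTranspose_iff] <;> intro x hx
  · rw [hmat]
    exact hK x hx
  · rw [← mulVec_mulVec, hmat]
    obtain ⟨C, hC0, hCx⟩ := hC (K.flip x)
    have h1 : ‖K x x‖ ^ 2 ≤ C * (K x (M *ᵥ x)).re := hCx x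
    have h2 : K x x ≠ 0 := fun h => (hK x hx).ne' (by rw [h, Complex.zero_re])
    exact pos_of_mul_pos_right (lt_of_lt_of_le (by positivity) h1) hC0.le

theorem stmt2 {n : ℕ} (A B : Matrix (Fin n) (Fin n) ℂ) (hA : IsUnit A) (hB : IsUnit B) :
    (∃ H : Matrix (Fin n) (Fin n) ℂ, IsUnit H ∧
        (H * A + (H * A)ᴴ).PosDef ∧ (Hᴴ * B + (Hᴴ * B)ᴴ).PosDef) ↔
      ∀ r : ℝ, r ≤ 0 → (r : ℂ) ∉ spectrum ℂ (A * B) := by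
  have hBdet := (isUnit_iff_isUnit_det B).1 hB
  have hBinj : ∀ v, v ≠ 0 → B *ᵥ v ≠ 0 := fun v hv h =>
    hv (mulVec_injective_of_isUnit hB (by rw [h, mulVec_zero]))
  constructor
  · rintro ⟨H, -, hHA, hHB⟩ r hr hmem
    rw [posDef_add_conjTranspose_iff] at hHA hHB
    rw [← Matrix.spectrum_toLin', ← Module.End.hasEigenvalue_iff_mem_spectrum] at hmem
    obtain ⟨v, hv⟩ := hmem.exists_hasEigenvector
    have hABv : A *ᵥ B *ᵥ v = (r : ℂ) • v := by
      simpa using hv.apply_eq_smul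
    have h1 := hHA _ (hBinj v hv.2)
    have h2 := hHB v hv.2
    have h3 : star (B *ᵥ v) ⬝ᵥ H *ᵥ v = star (star v ⬝ᵥ (Hᴴ * B) *ᵥ v) := by
      rw [star_dotProduct, ← mulVec_mulVec, star_mulVec, dotProduct_mulVec _ Hᴴ]
    rw [← mulVec_mulVec, hABv, mulVec_smul, dotProduct_smul, h3, smul_eq_mul,
      Complex.re_ofReal_mul] at h1
    have h4 : 0 < r * (star v ⬝ᵥ (Hᴴ * B) *ᵥ v).re := h1
    nlinarith
  · intro hM
    obtain ⟨K, hK, hKM⟩ := exists_accretive_mul_accretive (A * B) hM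
    have hKu : IsUnit K := by
      rw [posDef_add_conjTranspose_iff] at hK
      rw [← mulVec_injective_iff_isUnit]
      refine (injective_iff_map_eq_zero K.mulVecLin).2 fun x hx => ?_
      by_contra h
      have := hK x h
      rw [mulVecLin_apply] at hx
      simp [hx] at this
    refine ⟨(B⁻¹)ᴴ * K, ?_, ?_, ?_⟩
    · exact IsUnit.mul ((isUnit_nonsing_inv_iff.2 hB).star) hKu
    · rw [← IsUnit.posDef_star_left_conjugate_iff hB]
      convert hKM using 1
      have h1 : Bᴴ * (B⁻¹)ᴴ = 1 := by
        rw [← conjTranspose_mul, nonsing_inv_mul _ hBdet, conjTranspose_one]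
      have h2 : Bᴴ * ((B⁻¹)ᴴ * K * A) * B = K * (A * B) := by
        rw [← Matrix.mul_assoc, ← Matrix.mul_assoc, h1, Matrix.one_mul, Matrix.mul_assoc]
      rw [star_eq_conjTranspose, Matrix.mul_add, Matrix.add_mul, h2, ← h2]
      simp [Matrix.mul_assoc]
    · rw [conjTranspose_mul, conjTranspose_conjTranspose, Matrix.mul_assoc,
        nonsing_inv_mul _ hBdet, Matrix.mul_one, conjTranspose_conjTranspose, add_comm]
      exact hK
end

section
/- Let A, B ∈ M_n(ℂ) be such that every eigenvalue of A B avoids the strictly negative real axis, and such that 0, if it is an eigenvalue of A B, is semi-simple (its algebraic and geometric multiplicities coincide). Then there exist H ∈ M_n(ℂ) and ε > 0 such that H A + A* H* ⪰ ε A* A and H* B + B* H ⪰ 0. -/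
open Matrix ComplexOrder Polynomial

open scoped InnerProductSpace

section Accretive

variable {V : Type*} [NormedAddCommGroup V] [InnerProductSpace ℂ V] [FiniteDimensional ℂ V]

/-- A sesquilinear form with positive real part on a finite-dimensional space is coercive. -/
lemma exists_pos_mul_norm_sq_le_re_inner (K L : V →ₗ[ℂ] V)
    (h : ∀ x ≠ 0, 0 < (⟪K x, L x⟫_ℂ).re) :
    ∃ ε : ℝ, 0 < ε ∧ ∀ x, ε * ‖x‖ ^ 2 ≤ (⟪K x, L x⟫_ℂ).re := by
  have : ProperSpace V := FiniteDimensional.proper ℂ V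
  have hcont : Continuous fun x : V ↦ (⟪K x, L x⟫_ℂ).re := by
    have hK := K.continuous_of_finiteDimensional
    have hL := L.continuous_of_finiteDimensional
    exact Complex.continuous_re.comp (hK.inner hL)
  rcases (Metric.sphere (0 : V) 1).eq_empty_or_nonempty with hS | hS
  · refine ⟨1, one_pos, fun x ↦ ?_⟩
    by_cases hx : x = 0
    · simp [hx]
    · have hmem : ((‖x‖⁻¹ : ℝ) : ℂ) • x ∈ Metric.sphere (0 : V) 1 := by
        simp [norm_smul, hx]
      simp [hS] at hmem
  · obtain ⟨z, hz, hmin⟩ := (isCompact_sphere (0 : V) 1).exists_isMinOn hS hcont.continuousOn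
    have hz0 : z ≠ 0 := by
      rintro rfl
      simp at hz
    refine ⟨_, h z hz0, fun x ↦ ?_⟩
    by_cases hx : x = 0
    · simp [hx]
    · have hmem : ((‖x‖⁻¹ : ℝ) : ℂ) • x ∈ Metric.sphere (0 : V) 1 := by
        simp [norm_smul, hx]
      have hle := hmin hmem
      have hscale : (⟪K (((‖x‖⁻¹ : ℝ) : ℂ) • x), L (((‖x‖⁻¹ : ℝ) : ℂ) • x)⟫_ℂ).re
          = (‖x‖ ^ 2)⁻¹ * (⟪K x, L x⟫_ℂ).re := by
        rw [map_smul, map_smul, inner_smul_left, inner_smul_right, Complex.conj_ofReal,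
          Complex.re_ofReal_mul, Complex.re_ofReal_mul]
        ring
      have hpos : 0 < ‖x‖ ^ 2 := by positivity
      simp only [Set.mem_ofPred_eq, hscale] at hle
      rw [inv_mul_eq_div, le_div_iff₀ hpos] at hle
      exact hle

lemma Complex.norm_add_re_pos {z : ℂ} (hz : ∀ r : ℝ, r ≤ 0 → z ≠ r) : 0 < ‖z‖ + z.re := by
  have hle := (abs_le.mp (Complex.abs_re_le_norm z)).1
  rcases hle.lt_or_eq with h | h
  · linarith
  · refine absurd ?_ (hz z.re (by linarith [norm_nonneg z]))
    have him : z.im = 0 := by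
      have := Complex.sq_norm_sub_sq_re z
      rw [← h, neg_sq, sub_self] at this
      exact pow_eq_zero_iff two_ne_zero |>.mp this.symm
    exact Complex.ext rfl (by simp [him])

/-- An operator without eigenvalues in `(-∞, 0]` is strictly accretive with respect to some
strictly accretive sesquilinear form. -/
lemma exists_re_inner_pos (m : ℕ) : ∀ {V : Type*} [NormedAddCommGroup V] [InnerProductSpace ℂ V]
    [FiniteDimensional ℂ V] (N : V →ₗ[ℂ] V), Module.finrank ℂ V = m →
    (∀ r : ℝ, r ≤ 0 → ∀ x, N x = (r : ℂ) • x → x = 0) →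
    ∃ K : V →ₗ[ℂ] V, ∀ x ≠ 0, 0 < (⟪K x, x⟫_ℂ).re ∧ 0 < (⟪K x, N x⟫_ℂ).re := by
  induction m with
  | zero =>
    intro V _ _ _ N hdim _
    have := Module.finrank_zero_iff.mp hdim
    exact ⟨0, fun x hx ↦ absurd (Subsingleton.elim x 0) hx⟩
  | succ m ih =>
    intro V _ _ _ N hdim hN
    have : Nontrivial V := Module.nontrivial_of_finrank_pos (R := ℂ) (by omega)
    obtain ⟨μ, hμ⟩ := Module.End.exists_eigenvalue (LinearMap.adjoint N)
    obtain ⟨u, hu⟩ := hμ.exists_hasEigenvector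
    have hu0 : u ≠ 0 := hu.2
    have huN : LinearMap.adjoint N u = μ • u := hu.apply_eq_smul
    obtain ⟨z, rfl⟩ : ∃ z, μ = starRingEnd ℂ z := ⟨starRingEnd ℂ μ, by simp⟩
    have hφN (x : V) : ⟪u, N x⟫_ℂ = z * ⟪u, x⟫_ℂ := by
      rw [← LinearMap.adjoint_inner_left, huN, inner_smul_left]
      simp
    have hz : ∀ r : ℝ, r ≤ 0 → z ≠ r := by
      rintro r hr rfl
      have hinj : Function.Injective (N - (r : ℂ) • LinearMap.id : V →ₗ[ℂ] V) := by
        rw [injective_iff_map_eq_zero]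
        intro x hx
        exact hN r hr x (by simpa [sub_eq_zero] using hx)
      obtain ⟨y, hy⟩ := (LinearMap.injective_iff_surjective (K := ℂ) (V := V)).mp hinj u
      have h0 : ⟪u, u⟫_ℂ = 0 := by
        nth_rewrite 2 [← hy]
        simp [hφN]
      exact hu0 (inner_self_eq_zero.mp h0)
    have hzre := Complex.norm_add_re_pos hz
    have hz0 : 0 < ‖z‖ := norm_pos_iff.mpr fun h ↦ hz 0 le_rfl (by simpa using h)
    let φ : V →ₗ[ℂ] ℂ := innerₛₗ ℂ u
    have hφ (x : V) : φ x = ⟪u, x⟫_ℂ := rfl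
    obtain ⟨e, he⟩ : ∃ e, φ e = 1 :=
      ⟨(⟪u, u⟫_ℂ)⁻¹ • u, by
        rw [map_smul, hφ, smul_eq_mul, inv_mul_cancel₀ (inner_self_ne_zero.mpr hu0)]⟩
    let W : Submodule ℂ V := LinearMap.ker φ
    have hWdim : Module.finrank ℂ W = m := by
      have hsurj : LinearMap.range φ = ⊤ :=
        LinearMap.range_eq_top.mpr fun c ↦ ⟨c • e, by simp [he]⟩
      have := φ.finrank_range_add_finrank_ker
      rw [hsurj, finrank_top, Module.finrank_self] at this
      change 1 + Module.finrank ℂ W = _ at this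
      omega
    have hNW : ∀ x ∈ W, N x ∈ W := fun x hx ↦ by
      rw [LinearMap.mem_ker, hφ] at hx ⊢
      rw [hφN, hx, mul_zero]
    obtain ⟨K', hK'⟩ := ih (N.restrict hNW) hWdim fun r hr x hx ↦
      Subtype.ext (hN r hr x (by simpa using congrArg Subtype.val hx))
    obtain ⟨ε, hε, hcoer⟩ :=
      exists_pos_mul_norm_sq_le_re_inner K' (N.restrict hNW) fun x hx ↦ (hK' x hx).2
    let p : V →ₗ[ℂ] W := (LinearMap.id - φ.smulRight e).codRestrict W fun x ↦ by
      simp [W, he]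
    have hp (x : V) : (p x : V) = x - φ x • e := rfl
    have hpN (x : V) : p (N x) = N.restrict hNW (p x) + φ x • p (N e) := by
      have hx : N x = N (p x : V) + φ x • N e := by rw [hp]; simp
      have hpp : p (N (p x : V)) = N.restrict hNW (p x) := by
        apply Subtype.ext
        have : φ (N (p x : V)) = 0 := hNW _ (p x).2
        simp [hp (N (p x : V)), this]
      rw [hx, map_add, map_smul, hpp]
    obtain ⟨C, hC⟩ : ∃ C : ℝ, ∀ w, ‖⟪K' w, p (N e)⟫_ℂ‖ ≤ C * ‖w‖ := by
      refine ⟨‖LinearMap.toContinuousLinearMap K'‖ * ‖p (N e)‖, fun w ↦ ?_⟩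
      have h₁ := norm_inner_le_norm (𝕜 := ℂ) (K' w) (p (N e))
      have h₂ := (LinearMap.toContinuousLinearMap K').le_opNorm w
      simp only [LinearMap.coe_toContinuousLinearMap'] at h₂
      calc _ ≤ _ := h₁
        _ ≤ ‖LinearMap.toContinuousLinearMap K'‖ * ‖w‖ * ‖p (N e)‖ := by gcongr
        _ = _ := by ring
    set ρ : ℝ := ‖z‖ * (‖z‖ + z.re)
    have hρ0 : 0 < ρ := mul_pos hz0 hzre
    set t : ℝ := (C ^ 2 + 1) / (ρ * ε) with ht
    have ht0 : 0 < t := by positivity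
    have htρ : t * ρ * ε = C ^ 2 + 1 := by rw [ht]; field_simp
    let s : ℂ := t * (‖z‖ + z)
    let K : V →ₗ[ℂ] V := LinearMap.adjoint p ∘ₗ K' ∘ₗ p + φ.smulRight (s • u)
    have hK (x y : V) : ⟪K x, y⟫_ℂ = ⟪K' (p x), p y⟫_ℂ
        + starRingEnd ℂ s * (starRingEnd ℂ (φ x) * φ y) := by
      simp only [K, LinearMap.add_apply, inner_add_left, LinearMap.comp_apply,
        LinearMap.adjoint_inner_left, LinearMap.smulRight_apply, inner_smul_left, hφ]
      ring
    have hsplit (x : V) (hx : x ≠ 0) : φ x ≠ 0 ∨ p x ≠ 0 := by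
      by_contra! h
      have := hp x
      rw [h.1, h.2] at this
      exact hx (by simpa using this.symm)
    refine ⟨K, fun x hx ↦ ⟨?_, ?_⟩⟩
    · have hre : (starRingEnd ℂ s * (starRingEnd ℂ (φ x) * φ x)).re
          = t * (‖z‖ + z.re) * ‖φ x‖ ^ 2 := by
        rw [Complex.conj_mul', ← Complex.ofReal_pow, Complex.re_mul_ofReal]
        simp [s]
      rw [hK, Complex.add_re, hre]
      have hw : 0 ≤ (⟪K' (p x), p x⟫_ℂ).re := by
        by_cases h : p x = 0
        · simp [h]
        · exact (hK' _ h).1.le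
      rcases hsplit x hx with h | h
      · have : 0 < ‖φ x‖ := norm_pos_iff.mpr h
        positivity
      · have := (hK' _ h).1
        positivity
    · have hre : (starRingEnd ℂ s * (starRingEnd ℂ (φ x) * (z * φ x))).re
          = t * ρ * ‖φ x‖ ^ 2 := by
        have : starRingEnd ℂ s * (starRingEnd ℂ (φ x) * (z * φ x))
            = starRingEnd ℂ s * z * (starRingEnd ℂ (φ x) * φ x) := by ring
        rw [this, Complex.conj_mul', ← Complex.ofReal_pow, Complex.re_mul_ofReal]
        congr 1
        have hsz : starRingEnd ℂ s * z = t * (‖z‖ * z + (‖z‖ ^ 2 : ℝ)) := by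
          have := Complex.conj_mul' z
          simp only [s, map_mul, map_add, Complex.conj_ofReal, Complex.ofReal_pow]
          rw [← this]
          ring
        rw [hsz, Complex.re_ofReal_mul, Complex.add_re, Complex.re_ofReal_mul, Complex.ofReal_re]
        ring
      have hφNx : φ (N x) = z * φ x := hφN x
      rw [hK, hφNx, Complex.add_re, hre, hpN, inner_add_right, inner_smul_right, Complex.add_re]
      have h₁ := hcoer (p x)
      have h₂ : -(C * ‖φ x‖ * ‖p x‖) ≤ (φ x * ⟪K' (p x), p (N e)⟫_ℂ).re := by
        have := (abs_le.mp (Complex.abs_re_le_norm (φ x * ⟪K' (p x), p (N e)⟫_ℂ))).1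
        rw [norm_mul] at this
        have := mul_le_mul_of_nonneg_left (hC (p x)) (norm_nonneg (φ x))
        linarith
      suffices h : 0 < t * ρ * ‖φ x‖ ^ 2 + ε * ‖p x‖ ^ 2 - C * ‖φ x‖ * ‖p x‖ by linarith
      have hab : 0 < ‖φ x‖ ^ 2 + ε ^ 2 * ‖p x‖ ^ 2 := by
        rcases hsplit x hx with h | h
        · have : 0 < ‖φ x‖ := norm_pos_iff.mpr h
          positivity
        · have : 0 < ‖p x‖ := norm_pos_iff.mpr h
          positivity
      refine pos_of_mul_pos_right (a := ε) ?_ hε.le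
      have : ε * (t * ρ * ‖φ x‖ ^ 2 + ε * ‖p x‖ ^ 2 - C * ‖φ x‖ * ‖p x‖)
          = (C ^ 2 + 1) * ‖φ x‖ ^ 2 + ε ^ 2 * ‖p x‖ ^ 2 - C * ‖φ x‖ * (ε * ‖p x‖) := by
        rw [← htρ]; ring
      rw [this]
      nlinarith [sq_nonneg (C * ‖φ x‖ - ε * ‖p x‖), sq_nonneg (C * ‖φ x‖), norm_nonneg (φ x)]

/-- An operator without negative eigenvalues, for which `0` is at most a semi-simple eigenvalue, is
accretive with respect to some strictly accretive sesquilinear form. -/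
lemma exists_re_inner_nonneg (T : V →ₗ[ℂ] V)
    (hneg : ∀ r : ℝ, r < 0 → ∀ x, T x = (r : ℂ) • x → x = 0)
    (hss : ∀ x, T (T x) = 0 → T x = 0) :
    ∃ K : V →ₗ[ℂ] V, (∀ x ≠ 0, 0 < (⟪K x, x⟫_ℂ).re) ∧ ∀ x, 0 ≤ (⟪K x, T x⟫_ℂ).re := by
  have hcompl : IsCompl (LinearMap.range T) (LinearMap.ker T) := by
    rw [Submodule.isCompl_iff_disjoint _ _ T.finrank_range_add_finrank_ker.ge,
      Submodule.disjoint_def]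
    rintro _ ⟨x, rfl⟩ hx
    exact hss x hx
  have hTR : ∀ x ∈ LinearMap.range T, T x ∈ LinearMap.range T := fun x _ ↦ ⟨x, rfl⟩
  obtain ⟨K', hK'⟩ := exists_re_inner_pos _ (T.restrict hTR) rfl fun r hr x hx ↦ by
    have hx' : T x = (r : ℂ) • (x : V) := by simpa using congrArg Subtype.val hx
    rcases hr.lt_or_eq with hr | rfl
    · exact Subtype.ext (hneg r hr x hx')
    · obtain ⟨_, y, rfl⟩ := x
      exact Subtype.ext (hss y (by simpa using hx'))
  let p := (LinearMap.range T).projectionOnto (LinearMap.ker T) hcompl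
  let q : V →ₗ[ℂ] V := LinearMap.id - (LinearMap.range T).subtype ∘ₗ p
  have hq (x : V) : q x = x - p x := rfl
  have hpT (x : V) : p (T x) = T.restrict hTR (p x) := by
    have h₁ : p (T x) = ⟨T x, x, rfl⟩ :=
      Submodule.projectionOnto_apply_left hcompl ⟨T x, x, rfl⟩
    have h₂ : q x ∈ LinearMap.ker T := by
      rw [← Submodule.ker_projectionOnto hcompl, LinearMap.mem_ker, hq, map_sub, sub_eq_zero]
      exact (Submodule.projectionOnto_apply_left hcompl (p x)).symm
    rw [h₁]
    apply Subtype.ext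
    rw [LinearMap.mem_ker, hq, map_sub, sub_eq_zero] at h₂
    simpa using h₂
  have hqT (x : V) : q (T x) = 0 := by
    have h₁ : p (T x) = ⟨T x, x, rfl⟩ :=
      Submodule.projectionOnto_apply_left hcompl ⟨T x, x, rfl⟩
    rw [hq, h₁, sub_self]
  have hK (x y : V) : ⟪(LinearMap.adjoint p ∘ₗ K' ∘ₗ p + LinearMap.adjoint q ∘ₗ q) x, y⟫_ℂ
      = ⟪K' (p x), p y⟫_ℂ + ⟪q x, q y⟫_ℂ := by
    simp [LinearMap.adjoint_inner_left]
  refine ⟨LinearMap.adjoint p ∘ₗ K' ∘ₗ p + LinearMap.adjoint q ∘ₗ q, fun x hx ↦ ?_, fun x ↦ ?_⟩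
  · rw [hK, Complex.add_re]
    have hqq : (⟪q x, q x⟫_ℂ).re = ‖q x‖ ^ 2 := (norm_sq_eq_re_inner (𝕜 := ℂ) (q x)).symm
    rw [hqq]
    by_cases h : p x = 0
    · have : q x = x := by rw [hq, h]; simp
      have hx' : 0 < ‖x‖ := norm_pos_iff.mpr hx
      rw [h, this]
      simp only [map_zero, inner_zero_left, Complex.zero_re, zero_add]
      positivity
    · have := (hK' _ h).1
      positivity
  · rw [hK, hqT, inner_zero_right, add_zero, hpT]
    by_cases h : p x = 0
    · simp [h]
    · exact (hK' _ h).2.le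

end Accretive

/-- If `0` is at most a semi-simple eigenvalue of `M`, then `ker M ^ 2 = ker M`. -/
lemma Matrix.mulVec_eq_zero_of_semisimple {n : ℕ} (M : Matrix (Fin n) (Fin n) ℂ)
    (hss : (0 : ℂ) ∈ spectrum ℂ M → M.charpoly.rootMultiplicity 0 = n - M.rank)
    (x : Fin n → ℂ) (hx : M *ᵥ (M *ᵥ x) = 0) : M *ᵥ x = 0 := by
  by_cases h0 : (0 : ℂ) ∈ spectrum ℂ M
  · have hfin : Module.finrank ℂ (Module.End.maxGenEigenspace (toLin' M) 0)
        = Module.finrank ℂ (LinearMap.ker (toLin' M)) := by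
      have hrank : M.rank = Module.finrank ℂ (LinearMap.range (toLin' M)) := rfl
      have := (toLin' M).finrank_range_add_finrank_ker
      rw [Module.finrank_fin_fun] at this
      rw [LinearMap.finrank_maxGenEigenspace_eq, Matrix.charpoly_toLin', hss h0, hrank]
      omega
    have hle : LinearMap.ker (toLin' M) ≤ Module.End.maxGenEigenspace (toLin' M) 0 := by
      intro y hy
      rw [Module.End.mem_maxGenEigenspace]
      exact ⟨1, by simpa using hy⟩
    have heq := Submodule.eq_of_le_of_finrank_eq hle hfin.symm
    have hmem : x ∈ Module.End.maxGenEigenspace (toLin' M) 0 := by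
      rw [Module.End.mem_maxGenEigenspace]
      exact ⟨2, by simpa [pow_two] using hx⟩
    rw [← heq] at hmem
    simpa using hmem
  · rw [spectrum.zero_notMem_iff] at h0
    exact Matrix.mulVec_injective_of_isUnit h0 (by simpa using hx)

lemma Matrix.posSemidef_of_re_nonneg {n : ℕ} {Q : Matrix (Fin n) (Fin n) ℂ} (hQ : Q.IsHermitian)
    (h : ∀ x : Fin n → ℂ, 0 ≤ (star x ⬝ᵥ Q *ᵥ x).re) : Q.PosSemidef := by
  refine Matrix.posSemidef_iff_dotProduct_mulVec.mpr ⟨hQ, fun x ↦ ?_⟩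
  rw [Complex.nonneg_iff]
  exact ⟨h x, (hQ.im_star_dotProduct_mulVec_self x).symm⟩

lemma Matrix.re_star_dotProduct_add_conjTranspose_mulVec {n : ℕ} (P : Matrix (Fin n) (Fin n) ℂ)
    (x : Fin n → ℂ) : (star x ⬝ᵥ (P + Pᴴ) *ᵥ x).re = 2 * (star x ⬝ᵥ P *ᵥ x).re := by
  have h : star x ⬝ᵥ Pᴴ *ᵥ x = star (star x ⬝ᵥ P *ᵥ x) := by
    rw [dotProduct_mulVec, ← star_mulVec, star_dotProduct, dotProduct_comm]
  rw [add_mulVec, dotProduct_add, h, Complex.add_re, Complex.star_def, Complex.conj_re]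
  ring

theorem stmt5 {n : ℕ} (A B : Matrix (Fin n) (Fin n) ℂ)
    (hneg : ∀ r : ℝ, r < 0 → (r : ℂ) ∉ spectrum ℂ (A * B))
    (hss : (0 : ℂ) ∈ spectrum ℂ (A * B) →
      (A * B).charpoly.rootMultiplicity 0 = n - (A * B).rank) :
    ∃ (H : Matrix (Fin n) (Fin n) ℂ) (ε : ℝ), 0 < ε ∧
      (H * A + Aᴴ * Hᴴ - (ε : ℂ) • (Aᴴ * A)).PosSemidef ∧
      (Hᴴ * B + Bᴴ * H).PosSemidef := by
  obtain ⟨L, hL, hLT⟩ := exists_re_inner_nonneg (toEuclideanLin (A * B))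
    (fun r hr x hx ↦ by
      by_contra hx0
      refine hneg r hr ?_
      rw [← Matrix.spectrum_toLpLin 2, ← Module.End.hasEigenvalue_iff_mem_spectrum]
      exact Module.End.hasEigenvalue_of_hasEigenvector
        (Module.End.hasEigenvector_iff.mpr ⟨Module.End.mem_eigenspace_iff.mpr hx, hx0⟩))
    (fun x hx ↦ by
      have h := Matrix.mulVec_eq_zero_of_semisimple (A * B) hss x.ofLp
        (congrArg WithLp.ofLp hx)
      exact WithLp.ofLp_injective 2 (by simpa using h))
  obtain ⟨ε, hε, hcoer⟩ := exists_pos_mul_norm_sq_le_re_inner L LinearMap.id hL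
  obtain ⟨K, rfl⟩ := toEuclideanLin.surjective L
  have hinner (x y : Fin n → ℂ) : ⟪toEuclideanLin K (WithLp.toLp 2 x), WithLp.toLp 2 y⟫_ℂ
      = star x ⬝ᵥ Kᴴ *ᵥ y := by
    rw [EuclideanSpace.inner_eq_star_dotProduct, dotProduct_comm, dotProduct_mulVec, ← star_mulVec]
    simp
  have hnorm (x : Fin n → ℂ) : ‖WithLp.toLp 2 x‖ ^ 2 = (star x ⬝ᵥ x).re := by
    rw [norm_sq_eq_re_inner (𝕜 := ℂ), EuclideanSpace.inner_eq_star_dotProduct, dotProduct_comm]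
    rfl
  refine ⟨Aᴴ * K, ε, hε, Matrix.posSemidef_of_re_nonneg ?_ fun x ↦ ?_,
    Matrix.posSemidef_of_re_nonneg ?_ fun x ↦ ?_⟩
  · simp [Matrix.IsHermitian, Matrix.mul_assoc, add_comm]
  · have h := hcoer (WithLp.toLp 2 (A *ᵥ x))
    rw [LinearMap.id_apply, hinner, hnorm] at h
    have hnn : 0 ≤ ‖WithLp.toLp 2 (A *ᵥ x)‖ ^ 2 := by positivity
    rw [hnorm] at hnn
    have hmove (y : Fin n → ℂ) : star (A *ᵥ x) ⬝ᵥ y = star x ⬝ᵥ Aᴴ *ᵥ y := by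
      rw [dotProduct_mulVec, ← star_mulVec]
    rw [hmove, mulVec_mulVec, mulVec_mulVec, hmove, mulVec_mulVec, ← Matrix.mul_assoc] at h
    rw [hmove, mulVec_mulVec] at hnn
    have hP : Aᴴ * K * A + Aᴴ * (Aᴴ * K)ᴴ = Aᴴ * Kᴴ * A + (Aᴴ * Kᴴ * A)ᴴ := by
      simp [Matrix.mul_assoc, add_comm]
    rw [hP, sub_mulVec, dotProduct_sub, Complex.sub_re,
      Matrix.re_star_dotProduct_add_conjTranspose_mulVec, smul_mulVec, dotProduct_smul,
      smul_eq_mul, Complex.re_ofReal_mul]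
    nlinarith [mul_nonneg hε.le hnn]
  · simp [Matrix.IsHermitian, Matrix.mul_assoc, add_comm]
  · have h : 0 ≤ (⟪toEuclideanLin K (WithLp.toLp 2 x), WithLp.toLp 2 ((A * B) *ᵥ x)⟫_ℂ).re :=
      hLT (WithLp.toLp 2 x)
    rw [hinner, mulVec_mulVec] at h
    have hP : (Aᴴ * K)ᴴ * B + Bᴴ * (Aᴴ * K) = Kᴴ * (A * B) + (Kᴴ * (A * B))ᴴ := by
      simp [Matrix.mul_assoc]
    rw [hP, re_star_dotProduct_add_conjTranspose_mulVec]
    positivity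
end
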